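/- Fix ε > 0 and suppose the revealing probabilities are p_t = min((1+ε)·((a+b)/b)·κ*(a,b)/t, 1) for every t ≥ 1. Then P(MAP(Z_1, ..., Z_{t-1}, X_t) ≠ θ) = o(1/t) as t → ∞. -/

import Mathlib

open MeasureTheory ProbabilityTheory Filter Asymptotics
open scoped ENNReal NNReal

noncomputable section

/-- The constant `κ*(a,b)` from the paper. -/
def kappaStar (a b : ℝ) : ℝ :=
  1 / (1 + (a / b - 1) / Real.log (a / b) *
      (Real.log ((a / b - 1) / Real.log (a / b)) - 1))

/-- The signal distribution: `signalProb a b i x = P(X_t = x | θ = i)`,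
equal to `a/(a+b)` if `x = i` and `b/(a+b)` otherwise. -/
def signalProb (a b : ℝ) (i x : ℕ) : ℝ :=
  if x = i then a / (a + b) else b / (a + b)

/-- The D-likelihood `D_i^t = Q_i^t(Z_1,…,Z_{t-1},X_t)`: the conditional probability, given
`θ = i`, of observing the actions `Z_1,…,Z_{t-1}` and private signal `X_t` that actually
occurred at the sample point `ω`. -/
def Dlike {Ω : Type*} [MeasurableSpace Ω] (μ : Measure Ω) (θ : Ω → ℕ)
    (X Z : ℕ → Ω → ℕ) (t : ℕ) (i : ℕ) (ω : Ω) : ℝ :=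
  (μ {ω' | θ ω' = i ∧ (∀ s ∈ Finset.Icc 1 (t - 1), Z s ω' = Z s ω) ∧ X t ω' = X t ω}).toReal
    / (μ {ω' | θ ω' = i}).toReal

/-- The maximum a posteriori estimate of `θ` given `(Z_1,…,Z_{t-1},X_t)`, with ties broken
by following the private signal `X_t`.  (The prior on `θ` is uniform, so comparing the
posteriors amounts to comparing `D_1^t` and `D_2^t`.) -/
def mapEst {Ω : Type*} [MeasurableSpace Ω] (μ : Measure Ω) (θ : Ω → ℕ)
    (X Z : ℕ → Ω → ℕ) (t : ℕ) (ω : Ω) : ℕ :=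
  if Dlike μ θ X Z t 2 ω < Dlike μ θ X Z t 1 ω then 1
  else if Dlike μ θ X Z t 1 ω < Dlike μ θ X Z t 2 ω then 2
  else X t ω

/-- The L-likelihood `L_i^t = P_i(Z_1 = z_1, …, Z_t = z_t)` evaluated at the observed
actions. -/
def Llike {Ω : Type*} [MeasurableSpace Ω] (μ : Measure Ω) (θ : Ω → ℕ)
    (Z : ℕ → Ω → ℕ) (t : ℕ) (i : ℕ) (ω : Ω) : ℝ :=
  (μ {ω' | θ ω' = i ∧ ∀ s ∈ Finset.Icc 1 t, Z s ω' = Z s ω}).toReal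
    / (μ {ω' | θ ω' = i}).toReal

/-- The likelihood ratio `R_t = L_1^t / L_2^t` (with `R_0 = 1`). -/
def LR {Ω : Type*} [MeasurableSpace Ω] (μ : Measure Ω) (θ : Ω → ℕ)
    (Z : ℕ → Ω → ℕ) (t : ℕ) (ω : Ω) : ℝ :=
  Llike μ θ Z t 1 ω / Llike μ θ Z t 2 ω

/-- The sequential decision making model with Bayesians and revealers.
`θ` is the state of the world, uniform on `{1,2}`; given `θ`, the signals `X_t` are i.i.d.
with `P(X_t = θ | θ) = a/(a+b)`, the revealing indicators `I_t` are independent Bernoulli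
with `E[I_t] = p_t`, independent of everything else (this is the content of `joint`), and
the actions are `Z_t = X_t` if `I_t = 1` and `Z_t = MAP(Z_1,…,Z_{t-1},X_t)` if `I_t = 0`
(field `dynamics`).  Players are indexed by `t ≥ 1`; `Z 0` is set to the constant `1` for
definiteness. -/
structure IsCascade (a b : ℝ) (p : ℕ → ℝ) {Ω : Type*} [MeasurableSpace Ω]
    (μ : Measure Ω) (θ : Ω → ℕ) (X I Z : ℕ → Ω → ℕ) : Prop where
  prob : IsProbabilityMeasure μ
  theta_meas : Measurable θ
  X_meas : ∀ t, Measurable (X t)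
  I_meas : ∀ t, Measurable (I t)
  Z_meas : ∀ t, Measurable (Z t)
  p_mem : ∀ t : ℕ, 1 ≤ t → p t ∈ Set.Icc (0 : ℝ) 1
  theta_range : ∀ ω, θ ω = 1 ∨ θ ω = 2
  X_range : ∀ t ω, X t ω = 1 ∨ X t ω = 2
  I_range : ∀ t ω, I t ω = 0 ∨ I t ω = 1
  Z_zero : ∀ ω, Z 0 ω = 1
  joint : ∀ i : ℕ, i = 1 ∨ i = 2 → ∀ s : Finset ℕ, (∀ t ∈ s, 1 ≤ t) →
    ∀ x c : ℕ → ℕ, (∀ t, x t = 1 ∨ x t = 2) → (∀ t, c t = 0 ∨ c t = 1) →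
    (μ {ω | θ ω = i ∧ ∀ t ∈ s, X t ω = x t ∧ I t ω = c t}).toReal
      = 1 / 2 * ∏ t ∈ s, signalProb a b i (x t) * (if c t = 1 then p t else 1 - p t)
  dynamics : ∀ t : ℕ, 1 ≤ t → ∀ ω,
    Z t ω = if I t ω = 1 then X t ω else mapEst μ θ X Z t ω

/-- The error probability `E_t = P(Z_t ≠ θ)`. -/
def errProb {Ω : Type*} [MeasurableSpace Ω] (μ : Measure Ω) (θ : Ω → ℕ)
    (Z : ℕ → Ω → ℕ) (t : ℕ) : ℝ :=
  (μ {ω | Z t ω ≠ θ ω}).toReal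

/-- The probability that the MAP estimator is wrong at time `t`:
`P(MAP(Z_1,…,Z_{t-1},X_t) ≠ θ)`. -/
def mapErr {Ω : Type*} [MeasurableSpace Ω] (μ : Measure Ω) (θ : Ω → ℕ)
    (X Z : ℕ → Ω → ℕ) (t : ℕ) : ℝ :=
  (μ {ω | mapEst μ θ X Z t ω ≠ θ ω}).toReal

section Helpers

variable {Ω : Type*} [MeasurableSpace Ω] {μ : Measure Ω} {θ : Ω → ℕ} {X I Z : ℕ → Ω → ℕ}
  {a b : ℝ} {p : ℕ → ℝ}

/-- Splitting an event along a two-valued measurable function. -/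
lemma split_two [IsFiniteMeasure μ] (A : Set Ω) (f : Ω → ℕ) (hf : Measurable f) (u v : ℕ)
    (huv : u ≠ v) (hr : ∀ ω, f ω = u ∨ f ω = v) :
    μ.real A = μ.real (A ∩ {ω | f ω = u}) + μ.real (A ∩ {ω | f ω = v}) := by
  have hm : MeasurableSet {ω | f ω = u} := hf (measurableSet_singleton u)
  rw [← measureReal_inter_add_sdiff hm (s := A)]
  congr 2
  ext ω
  simp only [Set.mem_diff, Set.mem_inter_iff, Set.mem_ofPred_eq]
  rcases hr ω with h | h <;> simp [h, huv, huv.symm]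

/-- The event that the first `t` actions follow `z` and the state is `i`. -/
def histEv (θ : Ω → ℕ) (Z : ℕ → Ω → ℕ) (i t : ℕ) (z : ℕ → ℕ) : Set Ω :=
  {ω | θ ω = i ∧ ∀ s ∈ Finset.Icc 1 t, Z s ω = z s}

/-- Joint likelihood. -/
def hL (μ : Measure Ω) (θ : Ω → ℕ) (Z : ℕ → Ω → ℕ) (i t : ℕ) (z : ℕ → ℕ) : ℝ :=
  μ.real (histEv θ Z i t z)

/-- Revealing weight. -/
def wI (p : ℕ → ℝ) (t c : ℕ) : ℝ := if c = 1 then p t else 1 - p t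

/-- Deterministic MAP decision at time `t+1`. -/
def Mdec (μ : Measure Ω) (θ : Ω → ℕ) (X Z : ℕ → Ω → ℕ) (t : ℕ) (z : ℕ → ℕ) (x : ℕ) : ℕ :=
  if μ.real (histEv θ Z 2 t z ∩ {ω | X (t+1) ω = x})
      < μ.real (histEv θ Z 1 t z ∩ {ω | X (t+1) ω = x}) then 1
  else if μ.real (histEv θ Z 1 t z ∩ {ω | X (t+1) ω = x})
      < μ.real (histEv θ Z 2 t z ∩ {ω | X (t+1) ω = x}) then 2
  else x

/-- Action outcome at time `t+1`. -/
def outc (μ : Measure Ω) (θ : Ω → ℕ) (X Z : ℕ → Ω → ℕ) (t : ℕ) (z : ℕ → ℕ) (x c : ℕ) : ℕ :=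
  if c = 1 then x else Mdec μ θ X Z t z x

lemma theta_half (hC : IsCascade a b p μ θ X I Z) (i : ℕ) (hi : i = 1 ∨ i = 2) :
    (μ {ω | θ ω = i}).toReal = 1 / 2 := by
  have := hC.joint i hi ∅ (by simp) (fun _ => 1) (fun _ => 0) (by simp) (by simp)
  simpa using this

lemma mapEst_eq (hC : IsCascade a b p μ θ X I Z) (t : ℕ) (z : ℕ → ℕ) (ω : Ω)
    (h : ∀ s ∈ Finset.Icc 1 t, Z s ω = z s) :
    mapEst μ θ X Z (t+1) ω = Mdec μ θ X Z t z (X (t+1) ω) := by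
  have key : ∀ i, i = 1 ∨ i = 2 → Dlike μ θ X Z (t+1) i ω =
      2 * μ.real (histEv θ Z i t z ∩ {ω' | X (t+1) ω' = X (t+1) ω}) := by
    intro i hi
    unfold Dlike
    rw [theta_half hC i hi]
    have : {ω' | θ ω' = i ∧ (∀ s ∈ Finset.Icc 1 (t + 1 - 1), Z s ω' = Z s ω) ∧
        X (t+1) ω' = X (t+1) ω} = histEv θ Z i t z ∩ {ω' | X (t+1) ω' = X (t+1) ω} := by
      ext ω'
      simp only [histEv, Set.mem_inter_iff, Set.mem_ofPred_eq, Nat.add_sub_cancel, and_assoc]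
      constructor
      · rintro ⟨h1, h2, h3⟩
        exact ⟨h1, fun s hs => (h2 s hs).trans (h s hs), h3⟩
      · rintro ⟨h1, h2, h3⟩
        exact ⟨h1, fun s hs => (h2 s hs).trans (h s hs).symm, h3⟩
    rw [this, measureReal_def]
    ring
  unfold mapEst Mdec
  rw [key 1 (Or.inl rfl), key 2 (Or.inr rfl)]
  simp only [mul_lt_mul_iff_right₀ (two_pos : (0:ℝ) < 2)]

lemma Z_eq_outc (hC : IsCascade a b p μ θ X I Z) (t : ℕ) (z : ℕ → ℕ) (ω : Ω)
    (h : ∀ s ∈ Finset.Icc 1 t, Z s ω = z s) :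
    Z (t+1) ω = outc μ θ X Z t z (X (t+1) ω) (I (t+1) ω) := by
  rw [hC.dynamics (t+1) (by omega) ω, mapEst_eq hC t z ω h]
  rfl

/-- The event of prescribed signals and indicators on `s`. -/
def sigEv (X I : ℕ → Ω → ℕ) (s : Finset ℕ) (x c : ℕ → ℕ) : Set Ω :=
  {ω | ∀ u ∈ s, X u ω = x u ∧ I u ω = c u}

lemma mem_histEv_succ (i t : ℕ) (z : ℕ → ℕ) (ω : Ω) :
    ω ∈ histEv θ Z i (t+1) z ↔ ω ∈ histEv θ Z i t z ∧ Z (t+1) ω = z (t+1) := by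
  simp only [histEv, Set.mem_ofPred_eq, and_assoc]
  refine and_congr_right fun _ => ⟨fun h => ⟨fun s hs => h s ?_, h _ ?_⟩, fun h s hs => ?_⟩
  · simp only [Finset.mem_Icc] at *; omega
  · simp
  · rcases Nat.lt_or_ge s (t+1) with h' | h'
    · exact h.1 s (by simp only [Finset.mem_Icc] at *; omega)
    · have : s = t + 1 := by simp only [Finset.mem_Icc] at *; omega
      rw [this]; exact h.2

lemma indep_step (hC : IsCascade a b p μ θ X I Z) (i : ℕ) (t : ℕ) (z : ℕ → ℕ) (g : ℝ)
    (ih : ∀ s : Finset ℕ, (∀ u ∈ s, t < u) → ∀ x c : ℕ → ℕ, (∀ u, x u = 1 ∨ x u = 2) →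
      (∀ u, c u = 0 ∨ c u = 1) →
      μ.real (histEv θ Z i t z ∩ sigEv X I s x c) =
        g * ∏ u ∈ s, signalProb a b i (x u) * wI p u (c u))
    (s : Finset ℕ) (hs : ∀ u ∈ s, t + 1 < u) (x c : ℕ → ℕ) (hx : ∀ u, x u = 1 ∨ x u = 2)
    (hc : ∀ u, c u = 0 ∨ c u = 1) (x0 c0 : ℕ) (hx0 : x0 = 1 ∨ x0 = 2) (hc0 : c0 = 0 ∨ c0 = 1) :
    μ.real ((histEv θ Z i (t+1) z ∩ sigEv X I s x c) ∩ {ω | X (t+1) ω = x0} ∩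
        {ω | I (t+1) ω = c0}) =
      g * (if outc μ θ X Z t z x0 c0 = z (t+1) then signalProb a b i x0 * wI p (t+1) c0 else 0)
        * ∏ u ∈ s, signalProb a b i (x u) * wI p u (c u) := by
  have hns : t + 1 ∉ s := fun h => absurd (hs _ h) (lt_irrefl _)
  split_ifs with ho
  · have := ih (insert (t+1) s) (by
      intro u hu
      rcases Finset.mem_insert.1 hu with h | h
      · omega
      · have := hs u h; omega) (Function.update x (t+1) x0) (Function.update c (t+1) c0)
      (by intro u; by_cases h : u = t+1 <;> simp [Function.update_apply, h, hx0, hx])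
      (by intro u; by_cases h : u = t+1 <;> simp [Function.update_apply, h, hc0, hc])
    rw [Finset.prod_insert hns] at this
    have hprod : ∏ u ∈ s, signalProb a b i (Function.update x (t+1) x0 u) *
        wI p u (Function.update c (t+1) c0 u) =
        ∏ u ∈ s, signalProb a b i (x u) * wI p u (c u) := by
      refine Finset.prod_congr rfl fun u hu => ?_
      have : u ≠ t + 1 := fun h => hns (h ▸ hu)
      simp [Function.update_of_ne this]
    rw [hprod] at this
    simp only [Function.update_self] at this
    rw [mul_assoc, ← this]
    congr 1
    ext ω
    simp only [Set.mem_inter_iff, mem_histEv_succ, sigEv, Set.mem_ofPred_eq,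
      Finset.forall_mem_insert, Function.update_self]
    have hupd : (∀ u ∈ s, X u ω = x u ∧ I u ω = c u) ↔ (∀ u ∈ s,
        X u ω = Function.update x (t+1) x0 u ∧ I u ω = Function.update c (t+1) c0 u) := by
      refine forall₂_congr fun u hu => ?_
      have : u ≠ t + 1 := fun h => hns (h ▸ hu)
      simp [Function.update_of_ne this]
    rw [← hupd]
    constructor
    · rintro ⟨⟨⟨⟨h1, h2⟩, h3⟩, h4⟩, h5⟩
      exact ⟨h1, ⟨h4, h5⟩, h3⟩
    · rintro ⟨h1, ⟨h4, h5⟩, h3⟩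
      refine ⟨⟨⟨⟨h1, ?_⟩, h3⟩, h4⟩, h5⟩
      rw [Z_eq_outc hC t z ω h1.2, h4, h5, ho]
  · have : (histEv θ Z i (t+1) z ∩ sigEv X I s x c) ∩ {ω | X (t+1) ω = x0} ∩
        {ω | I (t+1) ω = c0} = ∅ := by
      ext ω
      simp only [Set.mem_inter_iff, mem_histEv_succ, Set.mem_ofPred_eq, Set.mem_empty_iff_false,
        iff_false]
      rintro ⟨⟨⟨⟨h1, h2⟩, h3⟩, h4⟩, h5⟩
      rw [Z_eq_outc hC t z ω h1.2, h4, h5] at h2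
      exact ho h2
    rw [this]; simp

/-- One-step transition weight. -/
def trW (μ : Measure Ω) (θ : Ω → ℕ) (X Z : ℕ → Ω → ℕ) (a b : ℝ) (p : ℕ → ℝ)
    (i t : ℕ) (z : ℕ → ℕ) (x0 c0 v : ℕ) : ℝ :=
  if outc μ θ X Z t z x0 c0 = v then signalProb a b i x0 * wI p (t+1) c0 else 0

lemma indep_step' (hC : IsCascade a b p μ θ X I Z) (i : ℕ) (t : ℕ) (z : ℕ → ℕ) (g : ℝ)
    (ih : ∀ s : Finset ℕ, (∀ u ∈ s, t < u) → ∀ x c : ℕ → ℕ, (∀ u, x u = 1 ∨ x u = 2) →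
      (∀ u, c u = 0 ∨ c u = 1) →
      μ.real (histEv θ Z i t z ∩ sigEv X I s x c) =
        g * ∏ u ∈ s, signalProb a b i (x u) * wI p u (c u))
    (s : Finset ℕ) (hs : ∀ u ∈ s, t + 1 < u) (x c : ℕ → ℕ) (hx : ∀ u, x u = 1 ∨ x u = 2)
    (hc : ∀ u, c u = 0 ∨ c u = 1) :
    μ.real (histEv θ Z i (t+1) z ∩ sigEv X I s x c) =
      g * (trW μ θ X Z a b p i t z 1 0 (z (t+1)) + trW μ θ X Z a b p i t z 1 1 (z (t+1))
        + trW μ θ X Z a b p i t z 2 0 (z (t+1)) + trW μ θ X Z a b p i t z 2 1 (z (t+1)))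
        * ∏ u ∈ s, signalProb a b i (x u) * wI p u (c u) := by
  have := hC.prob
  rw [split_two _ (X (t+1)) (hC.X_meas _) 1 2 (by norm_num) (hC.X_range _),
    split_two (_ ∩ {ω | X (t+1) ω = 1}) (I (t+1)) (hC.I_meas _) 0 1 (by norm_num) (hC.I_range _),
    split_two (_ ∩ {ω | X (t+1) ω = 2}) (I (t+1)) (hC.I_meas _) 0 1 (by norm_num) (hC.I_range _)]
  have h := indep_step hC i t z g ih s hs x c hx hc
  rw [h 1 0 (by simp) (by simp), h 1 1 (by simp) (by simp), h 2 0 (by simp) (by simp),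
    h 2 1 (by simp) (by simp)]
  unfold trW
  ring

lemma indep (hC : IsCascade a b p μ θ X I Z) (i : ℕ) (hi : i = 1 ∨ i = 2) (t : ℕ) (z : ℕ → ℕ) :
    ∀ s : Finset ℕ, (∀ u ∈ s, t < u) → ∀ x c : ℕ → ℕ, (∀ u, x u = 1 ∨ x u = 2) →
      (∀ u, c u = 0 ∨ c u = 1) →
      μ.real (histEv θ Z i t z ∩ sigEv X I s x c) =
        hL μ θ Z i t z * ∏ u ∈ s, signalProb a b i (x u) * wI p u (c u) := by
  induction t with
  | zero =>
    intro s hs x c hx hc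
    have h1 := hC.joint i hi s (fun t ht => hs t ht) x c hx hc
    have h2 := theta_half hC i hi
    have e1 : histEv θ Z i 0 z = {ω | θ ω = i} := by
      ext ω; simp [histEv]
    rw [hL, e1, measureReal_def, measureReal_def, h2]
    exact h1
  | succ t ih =>
    intro s hs x c hx hc
    have h1 := indep_step' hC i t z _ ih s hs x c hx hc
    have h2 := indep_step' hC i t z _ ih ∅ (by simp) x c hx hc
    rw [h1]
    congr 1
    rw [Finset.prod_empty, mul_one] at h2
    rw [← h2]
    simp [sigEv, hL]

lemma hL_succ (hC : IsCascade a b p μ θ X I Z) (i : ℕ) (hi : i = 1 ∨ i = 2) (t : ℕ)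
    (z : ℕ → ℕ) :
    hL μ θ Z i (t+1) z = hL μ θ Z i t z *
      (trW μ θ X Z a b p i t z 1 0 (z (t+1)) + trW μ θ X Z a b p i t z 1 1 (z (t+1))
        + trW μ θ X Z a b p i t z 2 0 (z (t+1)) + trW μ θ X Z a b p i t z 2 1 (z (t+1))) := by
  have h2 := indep_step' hC i t z _ (indep hC i hi t z) ∅ (by simp) (fun _ => 1) (fun _ => 0)
    (by simp) (by simp)
  rw [Finset.prod_empty, mul_one] at h2
  rw [← h2]
  simp [sigEv, hL]

lemma hist_X (hC : IsCascade a b p μ θ X I Z) (i : ℕ) (hi : i = 1 ∨ i = 2) (t : ℕ)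
    (z : ℕ → ℕ) (x : ℕ) (hx : x = 1 ∨ x = 2) :
    μ.real (histEv θ Z i t z ∩ {ω | X (t+1) ω = x}) = hL μ θ Z i t z * signalProb a b i x := by
  have := hC.prob
  rw [split_two _ (I (t+1)) (hC.I_meas _) 0 1 (by norm_num) (hC.I_range _)]
  have key : ∀ c, c = 0 ∨ c = 1 → μ.real (histEv θ Z i t z ∩ {ω | X (t+1) ω = x} ∩
      {ω | I (t+1) ω = c}) = hL μ θ Z i t z * (signalProb a b i x * wI p (t+1) c) := by
    intro c hc
    have := indep hC i hi t z {t+1} (by simp) (fun _ => x) (fun _ => c) (fun _ => hx)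
      (fun _ => hc)
    rw [Finset.prod_singleton] at this
    rw [← this]
    congr 1
    ext ω
    simp [sigEv, and_assoc]
  rw [key 0 (by simp), key 1 (by simp)]
  simp [wI]
  ring

lemma Mdec_eq (hC : IsCascade a b p μ θ X I Z) (t : ℕ) (z : ℕ → ℕ) (x : ℕ)
    (hx : x = 1 ∨ x = 2) : Mdec μ θ X Z t z x =
    if hL μ θ Z 2 t z * signalProb a b 2 x < hL μ θ Z 1 t z * signalProb a b 1 x then 1
    else if hL μ θ Z 1 t z * signalProb a b 1 x < hL μ θ Z 2 t z * signalProb a b 2 x then 2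
    else x := by
  unfold Mdec
  rw [hist_X hC 1 (by simp) t z x hx, hist_X hC 2 (by simp) t z x hx]

lemma hL_congr (i t : ℕ) (z : ℕ → ℕ) (v : ℕ) :
    hL μ θ Z i t (Function.update z (t+1) v) = hL μ θ Z i t z := by
  unfold hL histEv
  congr 1
  ext ω
  refine and_congr_right fun _ => forall₂_congr fun s hs => ?_
  have : s ≠ t + 1 := by simp only [Finset.mem_Icc] at hs; omega
  rw [Function.update_of_ne this]

/-- trichotomy of transitions -/
lemma trans_cases (hC : IsCascade a b p μ θ X I Z) (hb : 0 < b) (hab : b < a) (t : ℕ)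
    (z : ℕ → ℕ) (q : ℝ) (hq : q = p (t+1) * (b / (a+b))) :
    let L := hL μ θ Z
    let zz := fun v => Function.update z (t+1) v
    (L 2 t z ≤ L 1 t z ∧ L 1 (t+1) (zz 1) = L 1 t z * (1 - q) ∧ L 1 (t+1) (zz 2) = L 1 t z * q ∧
      L 2 (t+1) (zz 1) = L 2 t z * (1 - a / b * q) ∧ L 2 (t+1) (zz 2) = L 2 t z * (a / b * q)) ∨
    (L 1 t z ≤ L 2 t z ∧ L 2 (t+1) (zz 2) = L 2 t z * (1 - q) ∧ L 2 (t+1) (zz 1) = L 2 t z * q ∧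
      L 1 (t+1) (zz 2) = L 1 t z * (1 - a / b * q) ∧ L 1 (t+1) (zz 1) = L 1 t z * (a / b * q)) ∨
    (L 1 (t+1) (zz 1) = L 1 t z * (a / (a+b)) ∧ L 1 (t+1) (zz 2) = L 1 t z * (b / (a+b)) ∧
      L 2 (t+1) (zz 1) = L 2 t z * (b / (a+b)) ∧ L 2 (t+1) (zz 2) = L 2 t z * (a / (a+b))) := by
  intro L zz
  have ha : 0 < a := hb.trans hab
  have hS : ∀ i, i = 1 ∨ i = 2 → ∀ v, L i (t+1) (zz v) = L i t z *
      (trW μ θ X Z a b p i t z 1 0 v + trW μ θ X Z a b p i t z 1 1 v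
        + trW μ θ X Z a b p i t z 2 0 v + trW μ θ X Z a b p i t z 2 1 v) := by
    intro i hi v
    have h := hL_succ hC i hi t (zz v)
    have hM : ∀ x, x = 1 ∨ x = 2 → Mdec μ θ X Z t (zz v) x = Mdec μ θ X Z t z x := by
      intro x hx
      rw [Mdec_eq hC t _ x hx, Mdec_eq hC t _ x hx]
      simp only [zz, hL_congr]
    simp only [trW, outc, hM 1 (by simp), hM 2 (by simp)] at h
    simp only [trW, outc]
    rw [show L i (t+1) (zz v) = hL μ θ Z i (t+1) (zz v) from rfl, h]
    simp only [zz, hL_congr, Function.update_self]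
    rfl
  have hL0 : ∀ i, 0 ≤ L i t z := fun i => measureReal_nonneg
  have hM1 := Mdec_eq hC t z 1 (by simp)
  have hM2 := Mdec_eq hC t z 2 (by simp)
  change _ = if L 2 t z * _ < L 1 t z * _ then 1 else if L 1 t z * _ < L 2 t z * _ then 2 else 1
    at hM1
  change _ = if L 2 t z * _ < L 1 t z * _ then 1 else if L 1 t z * _ < L 2 t z * _ then 2 else 2
    at hM2
  simp only [signalProb] at hM1 hM2
  norm_num at hM1 hM2
  have hsum : 0 < a + b := by linarith
  have hdl : ∀ u v c d : ℝ, u * (c / (a+b)) < v * (d / (a+b)) ↔ u * c < v * d := by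
    intro u v c d
    rw [← mul_div_assoc, ← mul_div_assoc, div_lt_div_iff_of_pos_right hsum]
  simp only [hdl] at hM1 hM2
  simp only [hS 1 (by simp), hS 2 (by simp)]
  simp only [trW, outc, signalProb, wI]
  have h1 := hL0 1
  have h2 := hL0 2
  rcases lt_or_ge (L 2 t z * a) (L 1 t z * b) with hlt | hge
  · have e1 : L 2 t z * b < L 1 t z * a := by nlinarith
    rw [if_pos hlt] at hM2
    rw [if_pos e1] at hM1
    left
    refine ⟨by nlinarith, ?_, ?_, ?_, ?_⟩ <;> simp [hM1, hM2, hq] <;> left <;> field_simp <;> ring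
  · rcases lt_or_ge (L 1 t z * a) (L 2 t z * b) with hlt' | hge'
    · have e1 : L 1 t z * b < L 2 t z * a := by nlinarith
      rw [if_neg (not_lt.2 hge)] at hM2
      try simp at hM2
      rw [if_neg (by nlinarith), if_pos hlt'] at hM1
      right; left
      refine ⟨by nlinarith, ?_, ?_, ?_, ?_⟩ <;> simp [hM1, hM2, hq] <;> left <;> field_simp <;> ring
    · have e1 : Mdec μ θ X Z t z 1 = 1 := by
        rw [hM1, if_neg (not_lt.2 hge')]; simp
      have e2 : Mdec μ θ X Z t z 2 = 2 := by
        rw [hM2, if_neg (not_lt.2 hge)]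
      right; right
      refine ⟨?_, ?_, ?_, ?_⟩ <;> simp [e1, e2] <;> left <;> field_simp <;> ring

/-- Sum over histories. -/
def Sm : ℕ → ((ℕ → ℕ) → ℝ) → ℝ
  | 0, f => f (fun _ => 1)
  | (t+1), f => Sm t (fun z => f (Function.update z (t+1) 1) + f (Function.update z (t+1) 2))

lemma Sm_mono (t : ℕ) : ∀ f g : (ℕ → ℕ) → ℝ, (∀ z, f z ≤ g z) → Sm t f ≤ Sm t g := by
  induction t with
  | zero => intro f g h; exact h _
  | succ t ih => intro f g h; exact ih _ _ fun z => add_le_add (h _) (h _)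

lemma Sm_smul (t : ℕ) (k : ℝ) : ∀ f : (ℕ → ℕ) → ℝ, Sm t (fun z => k * f z) = k * Sm t f := by
  induction t with
  | zero => intro f; rfl
  | succ t ih => intro f; simp only [Sm]; rw [← ih]; simp only [mul_add]

lemma Sm_nonneg (t : ℕ) (f : (ℕ → ℕ) → ℝ) (h : ∀ z, 0 ≤ f z) : 0 ≤ Sm t f := by
  have := Sm_mono t (fun z => 0 * f z) f (by simpa using h)
  rw [Sm_smul] at this
  simpa using this

lemma Z_range (hC : IsCascade a b p μ θ X I Z) (t : ℕ) (ω : Ω) : Z t ω = 1 ∨ Z t ω = 2 := by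
  rcases t with _ | t
  · exact Or.inl (hC.Z_zero ω)
  · rw [hC.dynamics (t+1) (by omega) ω]
    unfold mapEst
    have := hC.X_range (t+1) ω
    split_ifs <;> simp [this]

lemma Sm_measure (hC : IsCascade a b p μ θ X I Z) (A : Set Ω) (t : ℕ) :
    μ.real A = Sm t (fun z => μ.real (A ∩ {ω | ∀ s ∈ Finset.Icc 1 t, Z s ω = z s})) := by
  have := hC.prob
  induction t with
  | zero => simp [Sm]
  | succ t ih =>
    rw [ih, Sm]
    congr 1
    funext z
    rw [split_two _ (Z (t+1)) (hC.Z_meas _) 1 2 (by norm_num) (Z_range hC (t+1))]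
    have key : ∀ v, A ∩ {ω | ∀ s ∈ Finset.Icc 1 t, Z s ω = z s} ∩ {ω | Z (t+1) ω = v} =
        A ∩ {ω | ∀ s ∈ Finset.Icc 1 (t+1), Z s ω = Function.update z (t+1) v s} := by
      intro v
      ext ω
      simp only [Set.mem_inter_iff, Set.mem_ofPred_eq, and_assoc]
      refine and_congr_right fun _ => ⟨fun h s hs => ?_, fun h => ⟨fun s hs => ?_, ?_⟩⟩
      · by_cases h' : s = t + 1
        · subst h'; rw [Function.update_self]; exact h.2
        · rw [Function.update_of_ne h']
          exact h.1 s (by simp only [Finset.mem_Icc] at *; omega)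
      · have := h s (by simp only [Finset.mem_Icc] at *; omega)
        rwa [Function.update_of_ne (by simp only [Finset.mem_Icc] at *; omega)] at this
      · simpa using h (t+1) (by simp)
    rw [key, key]

lemma mapErr_le (hC : IsCascade a b p μ θ X I Z) (hb : 0 < b) (hab : b < a) (t : ℕ) :
    mapErr μ θ X Z (t+1) ≤ Sm t (fun z => min (hL μ θ Z 1 t z) (hL μ θ Z 2 t z)) := by
  have := hC.prob
  have ha : 0 < a := hb.trans hab
  have hsum : a + b ≠ 0 := by linarith
  unfold mapErr
  rw [← measureReal_def, Sm_measure hC _ t]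
  refine Sm_mono t _ _ fun z => ?_
  rw [split_two _ (X (t+1)) (hC.X_meas _) 1 2 (by norm_num) (hC.X_range _)]
  have key : ∀ x, x = 1 ∨ x = 2 → μ.real ({ω | mapEst μ θ X Z (t+1) ω ≠ θ ω} ∩
      {ω | ∀ s ∈ Finset.Icc 1 t, Z s ω = z s} ∩ {ω | X (t+1) ω = x}) ≤
      min (hL μ θ Z 1 t z * signalProb a b 1 x) (hL μ θ Z 2 t z * signalProb a b 2 x) := by
    intro x hx
    have hM := Mdec_eq hC t z x hx
    have sub : ∀ i j, (i = 1 ∨ i = 2) → (∀ k, k = 1 ∨ k = 2 → k ≠ i → k = j) →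
        Mdec μ θ X Z t z x = i →
        {ω | mapEst μ θ X Z (t+1) ω ≠ θ ω} ∩ {ω | ∀ s ∈ Finset.Icc 1 t, Z s ω = z s} ∩
        {ω | X (t+1) ω = x} ⊆ histEv θ Z j t z ∩ {ω | X (t+1) ω = x} := by
      rintro i j hi hj hMi ω ⟨⟨h1, h2⟩, h3⟩
      refine ⟨⟨hj _ (hC.theta_range ω) ?_, h2⟩, h3⟩
      have e := mapEst_eq hC t z ω h2
      rw [show X (t+1) ω = x from h3, hMi] at e
      intro h
      exact h1 (e.trans h.symm)
    have b1 : Mdec μ θ X Z t z x = 1 → _ ≤ hL μ θ Z 2 t z * signalProb a b 2 x := fun h =>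
      (measureReal_mono (sub 1 2 (by simp) (by omega) h)).trans_eq
        (hist_X hC 2 (by simp) t z x hx)
    have b2 : Mdec μ θ X Z t z x = 2 → _ ≤ hL μ θ Z 1 t z * signalProb a b 1 x := fun h =>
      (measureReal_mono (sub 2 1 (by simp) (by omega) h)).trans_eq
        (hist_X hC 1 (by simp) t z x hx)
    split_ifs at hM with c1 c2
    · have := b1 hM
      exact le_min (this.trans c1.le) this
    · have := b2 hM
      exact le_min this (this.trans c2.le)
    · have heq := le_antisymm (not_lt.1 c1) (not_lt.1 c2)
      rcases hx with h | h
      · have := b1 (hM.trans h)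
        exact le_min (this.trans heq.ge) this
      · have := b2 (hM.trans h)
        exact le_min this (this.trans heq.le)
  refine (add_le_add (key 1 (by simp)) (key 2 (by simp))).trans ?_
  refine le_min ?_ ?_
  · refine (add_le_add (min_le_left _ _) (min_le_left _ _)).trans_eq ?_
    simp [signalProb]; field_simp
  · refine (add_le_add (min_le_right _ _) (min_le_right _ _)).trans_eq ?_
    simp [signalProb]; field_simp; ring

/-- Potential. -/
def Vp (l u v : ℝ) : ℝ := min (u ^ (1 - l) * v ^ l) (u ^ l * v ^ (1 - l))

lemma Vp_comm (l u v : ℝ) : Vp l u v = Vp l v u := by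
  unfold Vp; rw [min_comm, mul_comm, mul_comm (u ^ (1-l))]

lemma Vp_nonneg (l u v : ℝ) (hu : 0 ≤ u) (hv : 0 ≤ v) : 0 ≤ Vp l u v := by
  unfold Vp; positivity

lemma min_le_Vp (l u v : ℝ) (hl0 : 0 < l) (hl1 : l < 1) (hu : 0 ≤ u) (hv : 0 ≤ v) :
    min u v ≤ Vp l u v := by
  have hm : 0 ≤ min u v := le_min hu hv
  have key : ∀ k : ℝ, 0 < k → k < 1 → min u v ≤ u ^ (1 - k) * v ^ k := by
    intro k h0 h1
    calc min u v = (min u v) ^ (1 - k) * (min u v) ^ k := by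
          rw [← Real.rpow_add' hm (by norm_num)]; simp
      _ ≤ _ := by
          apply mul_le_mul
          · exact Real.rpow_le_rpow hm (min_le_left _ _) (by linarith)
          · exact Real.rpow_le_rpow hm (min_le_right _ _) h0.le
          · positivity
          · positivity
  refine le_min (key l hl0 hl1) ?_
  have := key (1-l) (by linarith) (by linarith)
  simpa using this

lemma Vp_of_le (l u v : ℝ) (hl : 1 / 2 ≤ l) (hl1 : l < 1) (hv : 0 ≤ v) (h : v ≤ u) :
    Vp l u v = u ^ (1 - l) * v ^ l := by
  unfold Vp
  apply min_eq_left
  have hu : 0 ≤ u := hv.trans h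
  rcases hv.eq_or_lt with h0 | h0
  · rw [← h0, Real.zero_rpow (by linarith), Real.zero_rpow (by linarith)]; simp
  have hu0 : 0 < u := h0.trans_le h
  have e1 : v ^ l = v ^ (1-l) * v ^ (2*l-1) := by rw [← Real.rpow_add h0]; ring_nf
  have e2 : u ^ l = u ^ (1-l) * u ^ (2*l-1) := by rw [← Real.rpow_add hu0]; ring_nf
  have := Real.rpow_le_rpow hv h (by linarith : 0 ≤ 2*l-1)
  rw [e1, e2]
  have h3 : 0 ≤ u ^ (1-l) * v ^ (1-l) := by positivity
  nlinarith [mul_le_mul_of_nonneg_left this h3]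

/-- cascade step -/
lemma cascade_step (l u v q r h : ℝ) (hl : 1 / 2 ≤ l) (hl1 : l < 1) (hv : 0 ≤ v) (huv : v ≤ u)
    (hr : 1 < r) (hq : 0 ≤ q) (hrq : r * q ≤ 1) (hh : r ^ l - 1 - l * (r - 1) = -h) :
    Vp l (u * (1 - q)) (v * (1 - r * q)) + Vp l (u * q) (v * (r * q)) ≤ (1 - q * h) * Vp l u v := by
  have hu : 0 ≤ u := hv.trans huv
  have hq1 : 0 ≤ 1 - q := by nlinarith
  have hq2 : 0 ≤ 1 - r * q := by linarith
  have hr0 : 0 ≤ r := by linarith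
  rw [Vp_of_le l u v hl hl1 hv huv]
  have e1 : Vp l (u * (1 - q)) (v * (1 - r * q)) ≤
      (u ^ (1-l) * v ^ l) * ((1-q) ^ (1-l) * (1 - r*q) ^ l) := by
    refine (min_le_left _ _).trans_eq ?_
    rw [Real.mul_rpow hu hq1, Real.mul_rpow hv hq2]; ring
  have e2 : Vp l (u * q) (v * (r * q)) ≤ (u ^ (1-l) * v ^ l) * (r ^ l * q) := by
    refine (min_le_left _ _).trans_eq ?_
    have : q ^ (1-l) * q ^ l = q := by rw [← Real.rpow_add' hq (by norm_num)]; simp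
    rw [Real.mul_rpow hu hq, Real.mul_rpow hv (by positivity), Real.mul_rpow hr0 hq]
    linear_combination (u ^ (1-l) * v ^ l * r ^ l) * this
  have e3 := Real.geom_mean_le_arith_mean2_weighted (by linarith : 0 ≤ 1 - l)
    (by linarith : 0 ≤ l) hq1 hq2 (by ring)
  have hW : 0 ≤ u ^ (1-l) * v ^ l := by positivity
  have e4 : (1-q) ^ (1-l) * (1 - r*q) ^ l + r ^ l * q ≤ 1 - q * h := by
    have : h = -(r ^ l - 1 - l * (r - 1)) := by linarith
    rw [this]; linarith
  calc _ ≤ _ := add_le_add e1 e2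
    _ = (u ^ (1-l) * v ^ l) * ((1-q) ^ (1-l) * (1 - r*q) ^ l + r ^ l * q) := by ring
    _ ≤ _ := by rw [mul_comm (1 - q * h)]; exact mul_le_mul_of_nonneg_left e4 hW

lemma mid_step (l u v A B : ℝ) (hu : 0 ≤ u) (hv : 0 ≤ v) (hA : 0 ≤ A) (hB : 0 ≤ B) :
    Vp l (u * A) (v * B) + Vp l (u * B) (v * A) ≤
      (A ^ (1-l) * B ^ l + B ^ (1-l) * A ^ l) * Vp l u v := by
  have hc : 0 ≤ (A ^ (1-l) * B ^ l + B ^ (1-l) * A ^ l) := by positivity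
  unfold Vp
  rw [mul_min_of_nonneg _ _ hc]
  simp only [Real.mul_rpow hu hA, Real.mul_rpow hu hB, Real.mul_rpow hv hA, Real.mul_rpow hv hB]
  refine le_min ?_ ?_
  · refine (add_le_add (min_le_left _ _) (min_le_left _ _)).trans_eq ?_
    ring
  · refine (add_le_add (min_le_right _ _) (min_le_right _ _)).trans_eq ?_
    ring

lemma mid_lt (l A B : ℝ) (hl0 : 0 < l) (hl1 : l < 1) (hB : 0 < B) (hAB : B < A)
    (hs : A + B = 1) : A ^ (1-l) * B ^ l + B ^ (1-l) * A ^ l < 1 := by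
  have hA : 0 < A := hB.trans hAB
  have e1 : A ^ (1-l) * A ^ l = A := by rw [← Real.rpow_add hA]; simp
  have e2 : B ^ (1-l) * B ^ l = B := by rw [← Real.rpow_add hB]; simp
  have h1 := Real.rpow_lt_rpow hB.le hAB hl0
  have h2 := Real.rpow_lt_rpow hB.le hAB (by linarith : 0 < 1 - l)
  nlinarith [mul_pos (sub_pos.2 h1) (sub_pos.2 h2)]

/-- The constant `1/κ*`. -/
lemma consts (r : ℝ) (hr : 1 < r) : ∃ l h : ℝ, 1/2 ≤ l ∧ l < 1 ∧ 0 < h ∧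
    r ^ l - 1 - l * (r - 1) = -h ∧
    1 + (r - 1) / Real.log r * (Real.log ((r - 1) / Real.log r) - 1) = h := by
  have hr0 : 0 < r := by linarith
  have hlog : 0 < Real.log r := Real.log_pos hr
  set c := (r - 1) / Real.log r with hc
  have hc1 : 1 < c := by
    rw [hc, lt_div_iff₀ hlog, one_mul]
    exact Real.log_lt_sub_one_of_pos hr0 hr.ne'
  have hc0 : 0 < c := by linarith
  have hcr : c < r := by
    rw [hc, div_lt_iff₀ hlog]
    have h1 := Real.log_lt_sub_one_of_pos (inv_pos.2 hr0) (by
      intro h; rw [inv_eq_one] at h; linarith)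
    rw [Real.log_inv] at h1
    have h2 : r * r⁻¹ = 1 := mul_inv_cancel₀ hr0.ne'
    nlinarith
  have hlogc : 0 < Real.log c := Real.log_pos hc1
  have hsq : Real.log r / 2 ≤ Real.log c := by
    rw [← Real.log_sqrt hr0.le]
    apply Real.log_le_log (Real.sqrt_pos.2 hr0)
    rw [hc, le_div_iff₀ hlog]
    have hs := Real.self_le_sinh_iff.2 (by positivity : 0 ≤ Real.log r / 2)
    rw [← Real.log_sqrt hr0.le, Real.sinh_log (Real.sqrt_pos.2 hr0), Real.log_sqrt hr0.le] at hs
    have hp := Real.sqrt_pos.2 hr0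
    have h1 : √r * (√r)⁻¹ = 1 := mul_inv_cancel₀ hp.ne'
    have h2 : √r * √r = r := Real.mul_self_sqrt hr0.le
    nlinarith
  refine ⟨Real.log c / Real.log r, 1 + c * (Real.log c - 1), ?_, ?_, ?_, ?_, rfl⟩
  · rw [le_div_iff₀ hlog]; linarith
  · rw [div_lt_one hlog]; exact Real.log_lt_log hc0 hcr
  · have h1 := Real.log_lt_sub_one_of_pos (inv_pos.2 hc0) (by
      intro h; rw [inv_eq_one] at h; linarith)
    rw [Real.log_inv] at h1
    have h2 : c * c⁻¹ = 1 := mul_inv_cancel₀ hc0.ne'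
    nlinarith
  · have e : r ^ (Real.log c / Real.log r) = c := by
      rw [Real.rpow_def_of_pos hr0, mul_div_cancel₀ _ hlog.ne', Real.exp_log hc0]
    have e2 : Real.log c / Real.log r * (r - 1) = c * Real.log c := by
      rw [hc]; ring
    rw [e, e2]; ring

end Helpers

/-- Lemma 2(a). If `p_t = min((1+ε)·((a+b)/b)·κ*(a,b)/t, 1)` for all
`t ≥ 1`, then `P(MAP(Z_1,…,Z_{t-1},X_t) ≠ θ) = o(1/t)` as `t → ∞`. -/
theorem map_error_little_o (a b : ℝ) (hb : 0 < b) (hab : b < a)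
    (ε : ℝ) (hε : 0 < ε) (p : ℕ → ℝ)
    (hp : ∀ t : ℕ, 1 ≤ t →
      p t = min ((1 + ε) * ((a + b) / b) * kappaStar a b / t) 1)
    {Ω : Type*} [MeasurableSpace Ω] (μ : Measure Ω) (θ : Ω → ℕ)
    (X I Z : ℕ → Ω → ℕ) (hC : IsCascade a b p μ θ X I Z) :
    (fun t : ℕ => mapErr μ θ X Z t) =o[Filter.atTop] (fun t : ℕ => 1 / (t : ℝ)) := by
  have ha : 0 < a := hb.trans hab
  have hsum : 0 < a + b := by linarith
  obtain ⟨l, h, hl, hl1, hh, hfl, hk⟩ := consts (a / b) ((one_lt_div hb).2 hab)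
  have hl0 : 0 < l := by linarith
  set S : ℕ → ℝ := fun t => Sm t (fun z => Vp l (hL μ θ Z 1 t z) (hL μ θ Z 2 t z)) with hS
  have hL0 : ∀ i t z, 0 ≤ hL μ θ Z i t z := fun i t z => measureReal_nonneg
  have hS0 : ∀ t, 0 ≤ S t := fun t => Sm_nonneg t _ fun z => Vp_nonneg _ _ _ (hL0 _ _ _) (hL0 _ _ _)
  have herr : ∀ t, mapErr μ θ X Z (t+1) ≤ S t := fun t =>
    (mapErr_le hC hb hab t).trans (Sm_mono t _ _ fun z =>
      min_le_Vp l _ _ hl0 hl1 (hL0 _ _ _) (hL0 _ _ _))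
  set m := (a/(a+b)) ^ (1-l) * (b/(a+b)) ^ l + (b/(a+b)) ^ (1-l) * (a/(a+b)) ^ l with hm
  have hm1 : m < 1 := mid_lt l _ _ hl0 hl1 (by positivity)
    (by rw [div_lt_div_iff_of_pos_right hsum]; exact hab) (by field_simp)
  have hstep : ∀ t : ℕ, ∀ q, q = p (t+1) * (b / (a+b)) → m ≤ 1 - q * h →
      S (t+1) ≤ (1 - q * h) * S t := by
    intro t q hq hmq
    have hp01 := hC.p_mem (t+1) (by omega)
    have hq0 : 0 ≤ q := by rw [hq]; exact mul_nonneg hp01.1 (by positivity)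
    have hrq : a / b * q ≤ 1 := by
      have e : a / b * q = p (t+1) * (a / (a+b)) := by rw [hq]; field_simp
      rw [e]
      have : a / (a+b) ≤ 1 := by rw [div_le_one hsum]; linarith
      exact mul_le_one₀ hp01.2 (by positivity) this
    simp only [hS]
    rw [← Sm_smul, Sm]
    refine Sm_mono t _ _ fun z => ?_
    have h1 := hL0 1 t z
    have h2 := hL0 2 t z
    rcases trans_cases hC hb hab t z q hq with ⟨hle, e1, e2, e3, e4⟩ | ⟨hle, e1, e2, e3, e4⟩ |
      ⟨e1, e2, e3, e4⟩
    · rw [e1, e2, e3, e4]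
      exact cascade_step l _ _ q (a/b) h hl hl1 h2 hle ((one_lt_div hb).2 hab) hq0 hrq hfl
    · rw [e1, e2, e3, e4, add_comm, Vp_comm l (_ * _), Vp_comm l (_ * (a / b * q)),
        Vp_comm l (hL μ θ Z 1 t z)]
      exact cascade_step l _ _ q (a/b) h hl hl1 h1 hle ((one_lt_div hb).2 hab) hq0 hrq hfl
    · rw [e1, e2, e3, e4]
      exact (mid_step l _ _ _ _ h1 h2 (by positivity) (by positivity)).trans
        (mul_le_mul_of_nonneg_right hmq (Vp_nonneg _ _ _ h1 h2))
  have hkap : kappaStar a b = 1 / h := by rw [kappaStar, hk]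
  set Kc := (1 + ε) * ((a + b) / b) * kappaStar a b with hKc
  obtain ⟨T, hT⟩ := exists_nat_ge (max (max Kc ((1+ε) / (1-m))) (1 + ε))
  have hTK : Kc ≤ T := (le_max_left _ _).trans ((le_max_left _ _).trans hT)
  have hTm : (1+ε)/(1-m) ≤ T := (le_max_right _ _).trans ((le_max_left _ _).trans hT)
  have hTe : 1 + ε ≤ T := (le_max_right _ _).trans hT
  have hrec : ∀ t : ℕ, T ≤ t → S (t+1) ≤ (1 - (1+ε)/((t+1 : ℕ):ℝ)) * S t := by
    intro t ht
    have htT : (T:ℝ) ≤ ((t+1 : ℕ) : ℝ) := by exact_mod_cast ht.trans (Nat.le_succ t)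
    have htpos : (0:ℝ) < ((t+1 : ℕ) : ℝ) := by positivity
    have hpt : p (t+1) = Kc / ((t+1 : ℕ) : ℝ) := by
      rw [hp (t+1) (by omega), min_eq_left]
      rw [div_le_one htpos]
      exact hTK.trans htT
    have hqh : p (t+1) * (b/(a+b)) * h = (1+ε)/((t+1 : ℕ):ℝ) := by
      rw [hpt, hKc, hkap]; field_simp
    have := hstep t _ rfl (by
      rw [hqh]
      have h1m : 0 < 1 - m := by linarith
      have := hTm.trans htT
      rw [div_le_iff₀ h1m] at this
      have : (1+ε)/((t+1 : ℕ):ℝ) ≤ 1 - m := by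
        rw [div_le_iff₀ htpos]; linarith
      linarith)
    rwa [hqh] at this
  have hbd : ∀ t : ℕ, T ≤ t → S t * (t:ℝ) ^ (1+ε) ≤ S T * (T:ℝ) ^ (1+ε) := by
    intro t ht
    induction t, ht using Nat.le_induction with
    | base => exact le_rfl
    | succ t ht ih =>
      refine le_trans ?_ ih
      have htpos : (0:ℝ) < ((t+1 : ℕ) : ℝ) := by positivity
      have hb1 := one_add_mul_self_le_rpow_one_add (s := -(1 / ((t+1 : ℕ):ℝ))) (by
        rw [neg_le_neg_iff, div_le_one htpos]; push_cast; linarith [Nat.cast_nonneg (α := ℝ) t])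
        (p := 1 + ε) (by linarith)
      have e1 : 1 + -(1 / ((t+1 : ℕ):ℝ)) = (t:ℝ) / ((t+1 : ℕ):ℝ) := by
        field_simp; push_cast; ring
      rw [e1, Real.div_rpow (by positivity) htpos.le] at hb1
      have hpw : 0 < ((t+1 : ℕ):ℝ) ^ (1+ε) := by positivity
      have h3 : 1 - (1+ε)/((t+1 : ℕ):ℝ) ≤ (t:ℝ)^(1+ε) / ((t+1 : ℕ):ℝ)^(1+ε) := by
        refine le_trans (le_of_eq ?_) hb1
        ring
      have h4 := (hrec t ht).trans (mul_le_mul_of_nonneg_right h3 (hS0 t))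
      calc _ ≤ (t:ℝ)^(1+ε) / ((t+1 : ℕ):ℝ)^(1+ε) * S t * ((t+1 : ℕ):ℝ)^(1+ε) :=
            mul_le_mul_of_nonneg_right h4 hpw.le
        _ = _ := by field_simp
  set C := S T * (T:ℝ) ^ (1+ε) with hCdef
  have hC0 : 0 ≤ C := mul_nonneg (hS0 T) (by positivity)
  rw [isLittleO_iff_tendsto' (by
    filter_upwards [eventually_gt_atTop 0] with t ht h0
    have : (0:ℝ) < 1 / t := by positivity
    linarith)]
  rw [← tendsto_add_atTop_iff_nat 1]
  have hlim : Tendsto (fun t : ℕ => 2 * C * (t:ℝ) ^ (-ε)) atTop (nhds 0) := by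
    have := ((tendsto_rpow_neg_atTop hε).comp tendsto_natCast_atTop_atTop).const_mul (2 * C)
    simpa using this
  refine squeeze_zero' (Eventually.of_forall fun t => ?_) ?_ hlim
  · exact div_nonneg ENNReal.toReal_nonneg (by positivity)
  · filter_upwards [eventually_ge_atTop T, eventually_ge_atTop 1] with t ht ht1
    have htp : (1:ℝ) ≤ t := by exact_mod_cast ht1
    have htp0 : (0:ℝ) < t := by linarith
    have h1 := hbd t ht
    have hpw : 0 < (t:ℝ) ^ ε := by positivity
    rw [Real.rpow_add htp0, Real.rpow_one] at h1
    rw [Real.rpow_neg htp0.le, ← div_eq_mul_inv, le_div_iff₀ hpw, div_div_eq_mul_div, div_one]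
    have h2 := herr t
    have h3 : ((t+1 : ℕ):ℝ) ≤ 2 * t := by push_cast; linarith
    calc _ ≤ S t * (2 * t) * (t:ℝ)^ε := by
          refine mul_le_mul_of_nonneg_right (mul_le_mul h2 h3 (by positivity) (hS0 t)) hpw.le
      _ = 2 * (S t * (t * (t:ℝ)^ε)) := by ring
      _ ≤ _ := by linarith
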